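/- Let n ∈ ℕ and let (M, f, s, mx, le, zero) be an interpretation satisfying the NiA clause set C(n). Then for every assignment x : ℕ → M, every k ∈ ℕ, and every i ≤ n, it is not the case that both f (x (k+1)) = num i and f (m k x (s (x (k+1)))) = num i. (Semantic content of: the clause f(x_{k+1}) = i, f(m(k, x̄_k, s(x_{k+1}))) = i ⊢ is derivable by resolution from C(n).) -/

import Mathlib

/-- Numerals in the interpretation: `num 0 = zero`, `num (k+1) = s (num k)`. -/
def num {M : Type*} (s : M → M) (zero : M) : ℕ → M
  | 0 => zero
  | k + 1 => s (num s zero k)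

/-- The iterated max term `m(k, x̄, t)`. -/
def itm {M : Type*} (s : M → M) (mx : M → M → M) : ℕ → (ℕ → M) → M → M
  | 0, _, t => t
  | k + 1, x, t => itm s mx k x (mx (s (x (k + 1))) t)

/-- An upper bound of an iterated max term is an upper bound of its last argument. -/
theorem le_of_itm_le {M : Type*} {s : M → M} {mx : M → M → M} {le : M → M → Prop}
    (le_right : ∀ a b c, le (mx a b) c → le b c) (x : ℕ → M) {c : M} :
    ∀ (k : ℕ) (t : M), le (itm s mx k x t) c → le t c
  | 0, _, h => h
  | k + 1, _, h => le_right _ _ _ (le_of_itm_le le_right x k _ h)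

theorem stmt8 {M : Type*} (n : ℕ) (f s : M → M) (mx : M → M → M)
    (le : M → M → Prop) (zero : M)
    (hC1 : ∀ a, le a a)
    (hC2 : ∀ a b c, le (mx a b) c → le a c)
    (hC3 : ∀ a b c, le (mx a b) c → le b c)
    (hC4 : ∀ k ≤ n, ∀ a b, ¬ (f b = num s zero k ∧ f a = num s zero k ∧ le (s b) a))
    (hC5 : ∀ a, ∃ i ≤ n, f a = num s zero i) :
    ∀ (x : ℕ → M) (k : ℕ), ∀ i ≤ n,
      ¬ (f (x (k + 1)) = num s zero i ∧
         f (itm s mx k x (s (x (k + 1)))) = num s zero i) := by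
  rintro x k i hi ⟨hx, hm⟩
  exact hC4 i hi _ _ ⟨hx, hm, le_of_itm_le hC3 x k _ (hC1 _)⟩
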